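/- Let (X_n) and (Y_n) be sequences in L²(Ω,ℙ) on a probability space (Ω,𝒜,ℙ). Then: (i) (X_n) converges in L² if and only if lim_{n→∞} E[X_n] exists and the double limit lim_{(n,m)→∞} Cov(X_n, X_m) exists (limit along the product filter atTop ×ˢ atTop); (ii) if X_n → X in L², then Y_n → X in L² if and only if lim_{n→∞} E[Y_n] = lim_{n→∞} E[X_n] and lim_{(n,m)→∞} Cov(Y_n, Y_m) = lim_{(n,m)→∞} Cov(X_n, X_m) = lim_{(n,m)→∞} Cov(Y_n, X_m). -/

import Mathlib

open MeasureTheory Filter Topology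

/-- Covariance of two elements of `L²(Ω,P)`: `Cov(U,V) = E[UV] − E[U]E[V]`. -/
noncomputable def covL2 {Ω : Type*} [MeasurableSpace Ω] {P : Measure Ω}
    (U V : Lp ℝ 2 P) : ℝ :=
  (∫ ω, (U : Ω → ℝ) ω * (V : Ω → ℝ) ω ∂P) -
    (∫ ω, (U : Ω → ℝ) ω ∂P) * (∫ ω, (V : Ω → ℝ) ω ∂P)

open scoped InnerProductSpace

section HilbertSpace

variable {E : Type*} [NormedAddCommGroup E] [InnerProductSpace ℝ E]

theorem tendsto_inner_prod {ι κ : Type*} {l : Filter ι} {l' : Filter κ} {U : ι → E} {V : κ → E}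
    {u v : E} (hU : Tendsto U l (𝓝 u)) (hV : Tendsto V l' (𝓝 v)) :
    Tendsto (fun q : ι × κ => ⟪U q.1, V q.2⟫_ℝ) (l ×ˢ l') (𝓝 ⟪u, v⟫_ℝ) :=
  (hU.comp tendsto_fst).inner (hV.comp tendsto_snd)

theorem tendsto_dist_zero_of_tendsto_inner {ι : Type*} {l : Filter ι} {U V : ι → E} {c : ℝ}
    (hUU : Tendsto (fun i => ⟪U i, U i⟫_ℝ) l (𝓝 c))
    (hVV : Tendsto (fun i => ⟪V i, V i⟫_ℝ) l (𝓝 c))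
    (hUV : Tendsto (fun i => ⟪U i, V i⟫_ℝ) l (𝓝 c)) :
    Tendsto (fun i => dist (U i) (V i)) l (𝓝 0) := by
  have h : Tendsto (fun i => ‖U i - V i‖ ^ 2) l (𝓝 0) := by
    have h := (hUU.sub (hUV.const_mul 2)).add hVV
    rw [show c - 2 * c + c = 0 by ring] at h
    refine h.congr fun i => ?_
    rw [norm_sub_sq_real, real_inner_self_eq_norm_sq, real_inner_self_eq_norm_sq]
  simpa [dist_eq_norm] using h.sqrt

theorem tendsto_diag {α : Type*} (l : Filter α) : Tendsto (fun a => (a, a)) l (l ×ˢ l) :=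
  tendsto_id.prodMk tendsto_id

theorem cauchySeq_of_tendsto_inner {U : ℕ → E} {c : ℝ}
    (h : Tendsto (fun q : ℕ × ℕ => ⟪U q.1, U q.2⟫_ℝ) (atTop ×ˢ atTop) (𝓝 c)) :
    CauchySeq U := by
  rw [cauchySeq_iff_tendsto_dist_atTop_0, ← prod_atTop_atTop_eq]
  have hd := h.comp (tendsto_diag atTop)
  exact tendsto_dist_zero_of_tendsto_inner (hd.comp tendsto_fst) (hd.comp tendsto_snd) h

theorem tendsto_of_tendsto_inner {ι : Type*} {l : Filter ι} {U V : ι → E} {u : E} {c : ℝ}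
    (hU : Tendsto U l (𝓝 u))
    (hVV : Tendsto (fun q : ι × ι => ⟪V q.1, V q.2⟫_ℝ) (l ×ˢ l) (𝓝 c))
    (hUU : Tendsto (fun q : ι × ι => ⟪U q.1, U q.2⟫_ℝ) (l ×ˢ l) (𝓝 c))
    (hVU : Tendsto (fun q : ι × ι => ⟪V q.1, U q.2⟫_ℝ) (l ×ˢ l) (𝓝 c)) :
    Tendsto V l (𝓝 u) := by
  have hd := tendsto_dist_zero_of_tendsto_inner (hVV.comp (tendsto_diag l))
    (hUU.comp (tendsto_diag l)) (hVU.comp (tendsto_diag l))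
  refine (tendsto_iff_of_dist ?_).1 hU
  simpa only [dist_comm] using hd

end HilbertSpace

section Covariance

variable {Ω : Type*} [MeasurableSpace Ω] {P : Measure Ω}

theorem covL2_eq_inner_sub (U V : Lp ℝ 2 P) :
    covL2 U V = ⟪U, V⟫_ℝ - (∫ ω, U ω ∂P) * ∫ ω, V ω ∂P := by
  simp [covL2, L2.inner_def, mul_comm]

theorem tendsto_integral_of_tendsto_L2 [IsFiniteMeasure P] {ι : Type*} {l : Filter ι}
    {U : ι → Lp ℝ 2 P} {u : Lp ℝ 2 P} (hU : Tendsto U l (𝓝 u)) :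
    Tendsto (fun i => ∫ ω, U i ω ∂P) l (𝓝 (∫ ω, u ω ∂P)) := by
  have h (V : Lp ℝ 2 P) :
      ⟪indicatorConstLp 2 MeasurableSet.univ (measure_ne_top P _) (1 : ℝ), V⟫_ℝ
        = ∫ ω, V ω ∂P := by
    rw [L2.inner_indicatorConstLp_one, setIntegral_univ]
  simp only [← h]
  exact tendsto_const_nhds.inner hU

theorem tendsto_covL2 [IsFiniteMeasure P] {ι κ : Type*} {l : Filter ι} {l' : Filter κ}
    {U : ι → Lp ℝ 2 P} {V : κ → Lp ℝ 2 P} {u v : Lp ℝ 2 P}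
    (hU : Tendsto U l (𝓝 u)) (hV : Tendsto V l' (𝓝 v)) :
    Tendsto (fun q : ι × κ => covL2 (U q.1) (V q.2)) (l ×ˢ l') (𝓝 (covL2 u v)) := by
  simp only [covL2_eq_inner_sub]
  exact (tendsto_inner_prod hU hV).sub
    (((tendsto_integral_of_tendsto_L2 hU).comp tendsto_fst).mul
      ((tendsto_integral_of_tendsto_L2 hV).comp tendsto_snd))

theorem tendsto_inner_of_tendsto_covL2 {ι κ : Type*} {l : Filter ι} {l' : Filter κ}
    {U : ι → Lp ℝ 2 P} {V : κ → Lp ℝ 2 P} {a b c : ℝ}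
    (hU : Tendsto (fun i => ∫ ω, U i ω ∂P) l (𝓝 a))
    (hV : Tendsto (fun i => ∫ ω, V i ω ∂P) l' (𝓝 b))
    (hUV : Tendsto (fun q : ι × κ => covL2 (U q.1) (V q.2)) (l ×ˢ l') (𝓝 c)) :
    Tendsto (fun q : ι × κ => ⟪U q.1, V q.2⟫_ℝ) (l ×ˢ l') (𝓝 (c + a * b)) := by
  refine (hUV.add ((hU.comp tendsto_fst).mul (hV.comp tendsto_snd))).congr fun q => ?_
  simp [covL2_eq_inner_sub]

end Covariance

/-- (i) An `L²` sequence converges iff its means converge and its covariances converge as a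
double limit; (ii) given `X_n → X` in `L²`, `Y_n → X` in `L²` iff the means of `(Y_n)` have the
same limit as those of `(X_n)` and the double limits of `Cov(Y_n,Y_m)`, `Cov(X_n,X_m)`,
`Cov(Y_n,X_m)` all coincide. -/
theorem l2_convergence_via_mean_and_cov
    {Ω : Type*} [MeasurableSpace Ω] (P : Measure Ω) [IsProbabilityMeasure P]
    (X Y : ℕ → Lp ℝ 2 P) :
    ((∃ L : Lp ℝ 2 P, Tendsto X atTop (𝓝 L)) ↔
      ((∃ a : ℝ, Tendsto (fun n => ∫ ω, (X n : Ω → ℝ) ω ∂P) atTop (𝓝 a)) ∧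
        (∃ c : ℝ, Tendsto (fun q : ℕ × ℕ => covL2 (X q.1) (X q.2))
          (atTop ×ˢ atTop) (𝓝 c)))) ∧
    (∀ L : Lp ℝ 2 P, Tendsto X atTop (𝓝 L) →
      (Tendsto Y atTop (𝓝 L) ↔
        ((∃ a : ℝ, Tendsto (fun n => ∫ ω, (Y n : Ω → ℝ) ω ∂P) atTop (𝓝 a) ∧
            Tendsto (fun n => ∫ ω, (X n : Ω → ℝ) ω ∂P) atTop (𝓝 a)) ∧
          (∃ c : ℝ, Tendsto (fun q : ℕ × ℕ => covL2 (Y q.1) (Y q.2))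
              (atTop ×ˢ atTop) (𝓝 c) ∧
            Tendsto (fun q : ℕ × ℕ => covL2 (X q.1) (X q.2))
              (atTop ×ˢ atTop) (𝓝 c) ∧
            Tendsto (fun q : ℕ × ℕ => covL2 (Y q.1) (X q.2))
              (atTop ×ˢ atTop) (𝓝 c))))) := by
  refine ⟨⟨?_, ?_⟩, fun L hX => ⟨fun hY => ?_, ?_⟩⟩
  · rintro ⟨L, hX⟩
    exact ⟨⟨_, tendsto_integral_of_tendsto_L2 hX⟩, ⟨_, tendsto_covL2 hX hX⟩⟩
  · rintro ⟨⟨a, ha⟩, c, hc⟩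
    exact cauchySeq_tendsto_of_complete
      (cauchySeq_of_tendsto_inner (tendsto_inner_of_tendsto_covL2 ha ha hc))
  · exact ⟨⟨_, tendsto_integral_of_tendsto_L2 hY, tendsto_integral_of_tendsto_L2 hX⟩,
      ⟨_, tendsto_covL2 hY hY, tendsto_covL2 hX hX, tendsto_covL2 hY hX⟩⟩
  · rintro ⟨⟨a, hYa, hXa⟩, c, hYY, hXX, hYX⟩
    exact tendsto_of_tendsto_inner hX (tendsto_inner_of_tendsto_covL2 hYa hYa hYY)
      (tendsto_inner_of_tendsto_covL2 hXa hXa hXX) (tendsto_inner_of_tendsto_covL2 hYa hXa hYX)
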